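/- arXiv:2410.16854 — 5 statements merged into one kernel-verified Lean document; each statement's English description precedes it below -/
import Mathlib

section
/- Let k ≥ 2 be an even integer, N = p₁⋯p_t a squarefree positive integer with distinct prime factors p₁,…,p_t, and ε an Atkin–Lehner eigensystem for Γ₀(N). Define 𝓔_{k,N}^{(ε)}(z) = Σ_{d∣N} ε(d) d^{k/2} E_k(dz) on the upper half-plane. Let γ = (u v; x w) ∈ SL₂(ℤ) and set M = gcd(x,N). Then the limit as t → +∞ of ((𝓔_{k,N}^{(ε)})|_k γ)(it) exists and equals −(B_k/(2k)) · ε(N/M) · (M/N)^{k/2} · ∏_{i=1}^t (1 + ε(p_i) p_i^{k/2}). (This is the constant term of the Fourier expansion of 𝓔_{k,N}^{(ε)} at the cusp 1/M of Γ₀(N).) -/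
open Filter Complex Finset

/-- The weight-k, level-1 Eisenstein series
E_k(z) = −B_k/(2k) + Σ_{n≥1} σ_{k−1}(n) e^{2πinz}, as a function on ℂ
(the series converges for Im z > 0 and every even k ≥ 2). -/
noncomputable def Ek (k : ℕ) (z : ℂ) : ℂ :=
  -(((bernoulli k : ℚ) : ℂ) / (2 * (k : ℂ))) +
    ∑' n : ℕ+, (∑ e ∈ (n : ℕ).divisors, (e : ℂ) ^ (k - 1)) *
      Complex.exp (2 * Real.pi * Complex.I * ((n : ℕ) : ℂ) * z)

theorem bernoulli_two_mul_ne_zero {m : ℕ} (hm : 1 ≤ m) : bernoulli (2 * m) ≠ 0 := by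
  intro h
  have h1 := riemannZeta_two_mul_nat (k := m) (by omega)
  rw [h] at h1
  refine riemannZeta_ne_zero_of_one_lt_re (s := 2 * (m : ℂ)) ?_ (by simpa using h1)
  norm_cast
  omega

open EisensteinSeries in
theorem Ek_eq_const_mul_E {m : ℕ} (hm : 2 ≤ m) (hk : 3 ≤ 2 * m) (z : UpperHalfPlane) :
    Ek (2 * m) z =
      -(((bernoulli (2 * m) : ℚ) : ℂ) / (2 * ((2 * m : ℕ) : ℂ))) * ModularForm.E hk z := by
  have hB : ((bernoulli (2 * m) : ℚ) : ℂ) ≠ 0 := by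
    exact_mod_cast bernoulli_two_mul_ne_zero (by omega)
  have hm0 : (m : ℂ) ≠ 0 := by
    exact_mod_cast (by omega : m ≠ 0)
  have hsum : ∑' n : ℕ+, (∑ e ∈ (n : ℕ).divisors, (e : ℂ) ^ (2 * m - 1)) *
      Complex.exp (2 * Real.pi * Complex.I * ((n : ℕ) : ℂ) * z) =
      ∑' n : ℕ+, (ArithmeticFunction.sigma (2 * m - 1) n : ℂ) *
        cexp (2 * Real.pi * Complex.I * z) ^ (n : ℤ) := by
    refine tsum_congr fun n => ?_
    rw [zpow_natCast, ← Complex.exp_nat_mul, ArithmeticFunction.sigma_apply]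
    push_cast
    congr 2
    ring
  rw [q_expansion_bernoulli hk (even_two_mul m), Ek, hsum]
  push_cast
  field_simp
  ring

open EisensteinSeries in
theorem Ek_two_eq_const_mul_E2 (z : UpperHalfPlane) : Ek 2 z = -(1 / 24) * E2 z := by
  have hsum : ∑' n : ℕ+, (∑ e ∈ (n : ℕ).divisors, (e : ℂ) ^ (2 - 1)) *
      Complex.exp (2 * Real.pi * Complex.I * ((n : ℕ) : ℂ) * z) =
      ∑' n : ℕ+, (ArithmeticFunction.sigma 1 n : ℂ) *
        cexp (2 * Real.pi * Complex.I * z) ^ (n : ℕ) := by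
    refine tsum_congr fun n => ?_
    rw [← Complex.exp_nat_mul, ArithmeticFunction.sigma_apply]
    push_cast
    congr 2
    ring
  rw [E2_eq_tsum_cexp, Ek, hsum, bernoulli_two]
  push_cast
  ring

open EisensteinSeries ModularForm in
/-- `Ek k` is modular of weight `k`, up to a quasimodular defect term. -/
theorem exists_Ek_transform {m : ℕ} (hm : 1 ≤ m) :
    ∃ C : ℂ, ∀ (γ : Matrix.SpecialLinearGroup (Fin 2) ℤ) (z : UpperHalfPlane),
      Ek (2 * m) ↑(γ • z) = UpperHalfPlane.denom γ z ^ (2 * m) *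
        (Ek (2 * m) z + C * ((γ 1 0 : ℤ) : ℂ) / UpperHalfPlane.denom γ z) := by
  rcases hm.eq_or_lt with rfl | hm
  · refine ⟨1 / 24 * (1 / (2 * riemannZeta 2)) * (2 * Real.pi * I), fun γ z => ?_⟩
    have h := congrFun (E2_slash_action γ) z
    have hd := UpperHalfPlane.denom_ne_zero γ z
    rw [SL_slash_apply, zpow_neg, ← div_eq_mul_inv, div_eq_iff (zpow_ne_zero _ hd)] at h
    rw [mul_one, Ek_two_eq_const_mul_E2, Ek_two_eq_const_mul_E2, h]
    simp only [Pi.sub_apply, Pi.smul_apply, D2, smul_eq_mul, zpow_ofNat]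
    ring
  · refine ⟨0, fun γ z => ?_⟩
    have hk : 3 ≤ 2 * m := by omega
    have hd := UpperHalfPlane.denom_ne_zero γ z
    have h : E hk (γ • z) = UpperHalfPlane.denom γ z ^ (2 * m) * E hk z := by
      have := congrFun (SlashInvariantForm.slash_action_eqn (E hk)
        (Matrix.SpecialLinearGroup.mapGL ℝ γ) ⟨γ, rfl⟩) z
      change ((⇑(E hk) : UpperHalfPlane → ℂ) ∣[((2 * m : ℕ) : ℤ)] γ) z = _ at this
      rw [SL_slash_apply, zpow_neg, ← div_eq_mul_inv, div_eq_iff (zpow_ne_zero _ hd)] at this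
      rw [this, zpow_natCast, mul_comm]
    rw [Ek_eq_const_mul_E hm hk, Ek_eq_const_mul_E hm hk, h]
    ring

theorem exists_Ek_moebius {m : ℕ} (hm : 1 ≤ m) :
    ∃ C : ℂ, ∀ (a b c d : ℤ) (_ : a * d - b * c = 1) (z : ℂ) (_ : 0 < z.im),
      Ek (2 * m) ((a * z + b) / (c * z + d)) = (c * z + d) ^ (2 * m) *
        (Ek (2 * m) z + C * c / (c * z + d)) := by
  obtain ⟨C, hC⟩ := exists_Ek_transform hm
  refine ⟨C, fun a b c d h z hz => ?_⟩
  obtain ⟨γ, h00, h01, h10, h11⟩ : ∃ γ : Matrix.SpecialLinearGroup (Fin 2) ℤ,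
      γ 0 0 = a ∧ γ 0 1 = b ∧ γ 1 0 = c ∧ γ 1 1 = d :=
    ⟨⟨!![a, b; c, d], by rw [Matrix.det_fin_two_of]; exact h⟩, rfl, rfl, rfl, rfl⟩
  have := hC γ ⟨z, hz⟩
  rw [UpperHalfPlane.coe_specialLinearGroup_apply, ModularGroup.denom_apply, h00, h01, h10,
    h11] at this
  simpa using this

theorem tendsto_Ek_atImInfty (k : ℕ) (hk : 1 ≤ k) {α : Type*} {l : Filter α} {f : α → ℂ}
    (hf : Tendsto (fun t => (f t).im) l atTop) :
    Tendsto (fun t => Ek k (f t)) l (nhds (-(((bernoulli k : ℚ) : ℂ) / (2 * (k : ℂ))))) := by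
  have key : Tendsto (fun t => ∑' n : ℕ+, (∑ e ∈ (n : ℕ).divisors, (e : ℂ) ^ (k - 1)) *
      Complex.exp (2 * Real.pi * Complex.I * ((n : ℕ) : ℂ) * f t)) l
      (nhds (∑' _ : ℕ+, (0 : ℂ))) := by
    have hnorm (n : ℕ+) (w : ℂ) : ‖Complex.exp (2 * Real.pi * Complex.I * ((n : ℕ) : ℂ) * w)‖ =
        Real.exp (-(2 * Real.pi * (n : ℕ) * w.im)) := by
      rw [Complex.norm_exp]
      congr 1
      simp [Complex.mul_re, Complex.mul_im]
    have hsum := (EisensteinSeries.summable_sigma_mul_cexp_pow hk UpperHalfPlane.I).norm.comp_injective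
      PNat.coe_injective
    refine tendsto_tsum_of_dominated_convergence (bound := fun n : ℕ+ =>
      ‖(∑ e ∈ (n : ℕ).divisors, (e : ℂ) ^ (k - 1)) *
        Complex.exp (2 * Real.pi * Complex.I * ((n : ℕ) : ℂ) * I)‖) ?_ ?_ ?_
    · refine hsum.congr fun n => ?_
      simp only [Function.comp_apply, ArithmeticFunction.sigma_apply, UpperHalfPlane.coe_I]
      rw [← Complex.exp_nat_mul]
      push_cast
      congr 3
      ring
    · intro n
      rw [tendsto_zero_iff_norm_tendsto_zero]
      simp only [norm_mul, hnorm]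
      rw [← mul_zero ‖∑ e ∈ (n : ℕ).divisors, (e : ℂ) ^ (k - 1)‖]
      refine Tendsto.const_mul _ (Real.tendsto_exp_neg_atTop_nhds_zero.comp ?_)
      refine hf.const_mul_atTop ?_
      have := Real.pi_pos
      have := n.pos
      positivity
    · filter_upwards [hf.eventually_ge_atTop 1] with t ht n
      rw [norm_mul, norm_mul, hnorm, hnorm]
      have := Real.pi_pos
      gcongr
      simpa using ht
  simpa [Ek] using key.const_add (-(((bernoulli k : ℚ) : ℂ) / (2 * (k : ℂ))))

theorem tendsto_inv_linear_mul_I (x w : ℤ) :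
    Tendsto (fun t : ℝ => (x : ℂ) / ((x : ℂ) * (t * I) + w)) atTop (nhds 0) := by
  rcases eq_or_ne x 0 with rfl | hx
  · simp
  have hx' : (x : ℂ) ≠ 0 := by exact_mod_cast hx
  simp only [div_eq_mul_inv]
  rw [← mul_zero (x : ℂ)]
  refine (tendsto_inv₀_cobounded.comp ?_).const_mul _
  rw [← tendsto_norm_atTop_iff_cobounded]
  refine tendsto_atTop_mono (fun t => Complex.abs_im_le_norm _) ?_
  have : Tendsto (fun t : ℝ => |(x : ℝ)| * t) atTop atTop :=
    tendsto_id.const_mul_atTop (abs_pos.mpr (by exact_mod_cast hx))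
  refine tendsto_atTop_mono (fun t => ?_) this
  simpa [abs_mul] using mul_le_mul_of_nonneg_left (le_abs_self t) (abs_nonneg (x : ℝ))

/-- The constant term of `E_k(dz)` at the cusp `γ∞` for `γ = (u, v; x, w)`. The proof uses that
`(d, 0; 0, 1) * γ` factors as an element of `SL₂(ℤ)` times an upper triangular
matrix with diagonal `(gcd d x, d / gcd d x)`. -/
theorem tendsto_slash_Ek_mul {m : ℕ} (hm : 1 ≤ m) {d : ℕ} (hd : 0 < d) {u v x w : ℤ}
    (hdet : u * w - v * x = 1) :
    Tendsto (fun t : ℝ => ((x : ℂ) * (t * I) + w)⁻¹ ^ (2 * m) *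
        Ek (2 * m) ((d : ℂ) * (((u : ℂ) * (t * I) + v) / ((x : ℂ) * (t * I) + w)))) atTop
      (nhds (((Int.gcd x d : ℂ) / d) ^ (2 * m) *
        -(((bernoulli (2 * m) : ℚ) : ℂ) / (2 * ((2 * m : ℕ) : ℂ))))) := by
  obtain ⟨C, hC⟩ := exists_Ek_moebius hm
  set g : ℕ := Int.gcd x d
  have hg0 : 0 < g := Int.gcd_pos_of_ne_zero_right _ (by exact_mod_cast hd.ne')
  obtain ⟨d', hd'⟩ : g ∣ d := by exact_mod_cast Int.gcd_dvd_right x (d : ℤ)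
  obtain ⟨x', hx'⟩ : (g : ℤ) ∣ x := Int.gcd_dvd_left x (d : ℤ)
  have hd'0 : 0 < d' := Nat.pos_of_ne_zero (by rintro rfl; omega)
  obtain ⟨p, q, hpq⟩ : ∃ p q : ℤ, p * x' + q * d' = 1 := by
    have h := Int.gcd_eq_gcd_ab x d
    refine ⟨Int.gcdA x d, Int.gcdB x d, mul_left_cancel₀ (a := (g : ℤ)) (by positivity) ?_⟩
    have hdZ : (d : ℤ) = g * d' := by exact_mod_cast hd'
    calc (g : ℤ) * (Int.gcdA x d * x' + Int.gcdB x d * d')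
        = (g * x') * Int.gcdA x d + (g * d') * Int.gcdB x d := by ring
      _ = g * 1 := by rw [← hx', ← hdZ, ← h, mul_one]
  have hdet' : (d' * u) * (q * w) - (g * v - u * (p * w)) * x' = 1 := by
    linear_combination (u * w) * hpq + hdet + v * hx'
  have hgC : (g : ℂ) ≠ 0 := by exact_mod_cast hg0.ne'
  have hd'C : (d' : ℂ) ≠ 0 := by exact_mod_cast hd'0.ne'
  have hdC : (d : ℂ) = g * d' := by exact_mod_cast hd'
  have hxC : (x : ℂ) = g * x' := by exact_mod_cast hx'
  have hpqC : (p : ℂ) * x' + q * d' = 1 := by exact_mod_cast hpq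
  have him (t : ℝ) : ((g * (t * I) + p * w) / d' : ℂ).im = g / d' * t := by
    rw [show ((g * (t * I) + p * w) / d' : ℂ) = ((g / d' * t : ℝ) : ℂ) * I + ((p * w / d' : ℝ) : ℂ)
      by push_cast; ring]
    simp
  have hlim : Tendsto (fun t : ℝ => ((g : ℂ) / d) ^ (2 * m) *
      (Ek (2 * m) ((g * (t * I) + p * w) / d') +
        C * ((d' : ℂ) / g) * ((x : ℂ) / ((x : ℂ) * (t * I) + w)))) atTop
      (nhds (((g : ℂ) / d) ^ (2 * m) *
        (-(((bernoulli (2 * m) : ℚ) : ℂ) / (2 * ((2 * m : ℕ) : ℂ))) +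
          C * ((d' : ℂ) / g) * 0))) := by
    refine ((tendsto_Ek_atImInfty (2 * m) (by omega) ?_).add
      ((tendsto_inv_linear_mul_I x w).const_mul _)).const_mul _
    simp only [him]
    exact tendsto_id.const_mul_atTop (by positivity)
  rw [mul_zero, add_zero] at hlim
  refine hlim.congr' ?_
  filter_upwards [eventually_gt_atTop 0] with t ht
  have hD : (x : ℂ) * (t * I) + w ≠ 0 := by
    intro h
    have hx0 : x = 0 := by
      have := congrArg Complex.im h
      simpa [ht.ne'] using this
    have hw0 : w = 0 := by simpa [hx0] using h
    simp [hx0, hw0] at hdet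
  have htrans := hC _ _ _ _ hdet' ((g * (t * I) + p * w) / d') (by rw [him]; positivity)
  have hden : (x' : ℂ) * ((g * (t * I) + p * w) / d') + ((q * w : ℤ) : ℂ) =
      ((x : ℂ) * (t * I) + w) / d' := by
    rw [hxC]
    push_cast
    field_simp
    linear_combination (w : ℂ) * hpqC
  have hnum : ((d' * u : ℤ) : ℂ) * ((g * (t * I) + p * w) / d') +
      ((g * v - u * (p * w) : ℤ) : ℂ) = g * (u * (t * I) + v) := by
    push_cast
    field_simp
    ring
  rw [hden, hnum] at htrans
  have harg : (d : ℂ) * (((u : ℂ) * (t * I) + v) / ((x : ℂ) * (t * I) + w)) =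
      g * (u * (t * I) + v) / (((x : ℂ) * (t * I) + w) / d') := by
    rw [hdC]
    field_simp
  rw [harg, htrans, ← mul_assoc ((_ : ℂ)⁻¹ ^ (2 * m)), ← mul_pow]
  congr 2
  · rw [hdC]
    generalize (x : ℂ) * (t * I) + w = D at hD
    field_simp
  · rw [hxC] at hD ⊢
    field_simp

theorem sum_divisors_and_prod_of_multiplicative_on_divisors {N : ℕ} (hN : Squarefree N)
    {F : ℕ → ℂ} (h1 : F 1 = 1)
    (hmul : ∀ a b, a ∣ N → b ∣ N → Nat.Coprime a b → F (a * b) = F a * F b) :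
    F N = ∏ p ∈ N.primeFactors, F p ∧
      ∑ d ∈ N.divisors, F d = ∏ p ∈ N.primeFactors, (1 + F p) := by
  let f : ArithmeticFunction ℂ :=
    ⟨fun n => if n ∣ N then F n else 0, by simp [hN.ne_zero]⟩
  have hf (n : ℕ) (hn : n ∣ N) : f n = F n := if_pos hn
  have hf' (n : ℕ) (hn : ¬ n ∣ N) : f n = 0 := if_neg hn
  have hfm : f.IsMultiplicative := by
    refine ⟨by rw [hf 1 (one_dvd _), h1], fun {a b} hab => ?_⟩
    by_cases ha : a ∣ N
    · by_cases hb : b ∣ N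
      · rw [hf a ha, hf b hb, hf _ (hab.mul_dvd_of_dvd_of_dvd ha hb), hmul a b ha hb hab]
      · rw [hf' b hb, hf' _ fun h => hb (dvd_of_mul_left_dvd h), mul_zero]
    · rw [hf' a ha, hf' _ fun h => ha (dvd_of_mul_right_dvd h), zero_mul]
  constructor
  · rw [← hf N dvd_rfl, ← hfm.prod_primeFactors hN]
    exact prod_congr rfl fun p hp => hf p (Nat.dvd_of_mem_primeFactors hp)
  · rw [sum_congr rfl fun d hd => (hf d (Nat.dvd_of_mem_divisors hd)).symm,
      ← hfm.prodPrimeFactors_one_add_of_squarefree hN]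
    exact prod_congr rfl fun p hp => by rw [hf p (Nat.dvd_of_mem_primeFactors hp)]

theorem sum_divisors_atkinLehner (m : ℕ) {N : ℕ} (hN : Squarefree N)
    {ε : ℕ → ℤ} (hε1 : ε 1 = 1) (hεpm : ∀ d, d ∣ N → ε d = 1 ∨ ε d = -1)
    (hεmul : ∀ d₁ d₂, d₁ ∣ N → d₂ ∣ N → Nat.Coprime d₁ d₂ → ε (d₁ * d₂) = ε d₁ * ε d₂)
    (x : ℕ) :
    ∑ d ∈ N.divisors, (ε d : ℂ) * (d : ℂ) ^ m * ((Nat.gcd x d : ℂ) / d) ^ (2 * m) =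
      (ε (N / Nat.gcd x N) : ℂ) * ((Nat.gcd x N : ℂ) / N) ^ m *
        ∏ p ∈ N.primeFactors, (1 + (ε p : ℂ) * (p : ℂ) ^ m) := by
  have hF := (sum_divisors_and_prod_of_multiplicative_on_divisors hN
    (F := fun d => (ε d : ℂ) * (d : ℂ) ^ m * ((Nat.gcd x d : ℂ) / d) ^ (2 * m))
    (by simp [hε1]) (fun a b ha hb hab => by
      simp only [hεmul a b ha hb hab, hab.gcd_mul x]
      push_cast
      ring)).2
  have hH := (sum_divisors_and_prod_of_multiplicative_on_divisors hN
    (F := fun d => (ε (d / Nat.gcd x d) : ℂ) * ((Nat.gcd x d : ℂ) / d) ^ m)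
    (by simp [hε1]) (fun a b ha hb hab => by
      have hag := Nat.gcd_dvd_right x a
      have hbg := Nat.gcd_dvd_right x b
      have ha' := Nat.div_dvd_of_dvd hag
      have hb' := Nat.div_dvd_of_dvd hbg
      simp only [hab.gcd_mul x, ← Nat.div_mul_div_comm hag hbg,
        hεmul _ _ (ha'.trans ha) (hb'.trans hb) (hab.of_dvd ha' hb')]
      push_cast
      ring)).1
  rw [hF, hH, ← prod_mul_distrib]
  refine prod_congr rfl fun p hp => ?_
  have hpp := Nat.prime_of_mem_primeFactors hp
  have hp0 : (p : ℂ) ≠ 0 := by exact_mod_cast hpp.ne_zero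
  by_cases hpx : p ∣ x
  · rw [Nat.gcd_eq_right hpx, Nat.div_self hpp.pos, hε1]
    simp [hp0]
  · rw [Nat.Coprime.gcd_eq_one ((hpp.coprime_iff_not_dvd.mpr hpx).symm), Nat.div_one]
    have hsq : (ε p : ℂ) ^ 2 = 1 := by
      rcases hεpm p (Nat.dvd_of_mem_primeFactors hp) with h | h <;> simp [h]
    simp only [Nat.cast_one, one_div, inv_pow, pow_mul' _ 2 m, pow_two]
    field_simp
    linear_combination -(p : ℂ) ^ m * hsq

/-- Let k = 2m ≥ 2 be even, N squarefree, ε an Atkin–Lehner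
eigensystem for Γ₀(N), and 𝓔_{k,N}^{(ε)}(z) = Σ_{d∣N} ε(d) d^{k/2} E_k(dz).
For γ = (u v; x w) ∈ SL₂(ℤ) and M = gcd(x,N), the limit as t → +∞ of
((𝓔_{k,N}^{(ε)})|_k γ)(it) exists and equals
−(B_k/(2k)) ε(N/M) (M/N)^{k/2} ∏_{p∣N} (1 + ε(p) p^{k/2}). -/
theorem constant_term_eisenstein_at_cusp
    (k m : ℕ) (hm : 1 ≤ m) (hk : k = 2 * m)
    (N : ℕ) (hN : Squarefree N) (hN0 : 0 < N)
    (ε : ℕ → ℤ) (hε1 : ε 1 = 1)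
    (hεpm : ∀ d, d ∣ N → ε d = 1 ∨ ε d = -1)
    (hεmul : ∀ d₁ d₂, d₁ ∣ N → d₂ ∣ N → Nat.Coprime d₁ d₂ → ε (d₁ * d₂) = ε d₁ * ε d₂)
    (u v x w : ℤ) (hdet : u * w - v * x = 1)
    (M : ℕ) (hM : M = Int.gcd x (N : ℤ)) :
    Tendsto (fun t : ℝ =>
        ((x : ℂ) * (t * Complex.I) + (w : ℂ))⁻¹ ^ k *
          ∑ d ∈ N.divisors, (ε d : ℂ) * (d : ℂ) ^ m *
            Ek k ((d : ℂ) * (((u : ℂ) * (t * Complex.I) + (v : ℂ)) /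
              ((x : ℂ) * (t * Complex.I) + (w : ℂ)))))
      atTop
      (nhds (-(((bernoulli k : ℚ) : ℂ) / (2 * (k : ℂ))) * (ε (N / M) : ℂ) *
        ((M : ℂ) / (N : ℂ)) ^ m *
        ∏ p ∈ N.primeFactors, (1 + (ε p : ℂ) * (p : ℂ) ^ m))) := by
  subst hk hM
  rw [Int.gcd_eq_natAbs_gcd_natAbs, Int.natAbs_natCast]
  have hlim : Tendsto (fun t : ℝ => ∑ d ∈ N.divisors, (ε d : ℂ) * (d : ℂ) ^ m *
      (((x : ℂ) * (t * Complex.I) + (w : ℂ))⁻¹ ^ (2 * m) *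
        Ek (2 * m) ((d : ℂ) * (((u : ℂ) * (t * Complex.I) + (v : ℂ)) /
          ((x : ℂ) * (t * Complex.I) + (w : ℂ)))))) atTop
      (nhds (∑ d ∈ N.divisors, (ε d : ℂ) * (d : ℂ) ^ m *
        (((Int.gcd x d : ℂ) / d) ^ (2 * m) *
          -(((bernoulli (2 * m) : ℚ) : ℂ) / (2 * ((2 * m : ℕ) : ℂ)))))) :=
    tendsto_finsetSum _ fun d hd =>
      (tendsto_slash_Ek_mul hm (Nat.pos_of_mem_divisors hd) hdet).const_mul _
  have hval := sum_divisors_atkinLehner m hN hε1 hεpm hεmul x.natAbs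
  simp only [Int.gcd_eq_natAbs_gcd_natAbs, Int.natAbs_natCast, ← mul_assoc] at hlim
  rw [← sum_mul, hval] at hlim
  convert hlim using 2 with t
  · rw [mul_sum]
    exact sum_congr rfl fun d _ => by ring_nf
  · ring
end

section
/- Let k ≥ 2 be an even integer, N a squarefree positive integer, ε an Atkin–Lehner eigensystem for Γ₀(N), and p a prime dividing N. For m ≥ 1 set a(m) = Σ_{d∣N} ε(d) d^{k/2} σ_{k−1}(m/d), with the convention σ_{k−1}(m/d) = 0 when d ∤ m. Then for every integer n ≥ 1: a(pn) = (1 + p^{k−1} + ε(p) p^{k/2}) · a(n) − (1 + ε(p) p^{k/2})(1 + ε(p) p^{k/2−1}) · Σ_{d∣N, p∣d} ε(d) d^{k/2} σ_{k−1}(n/d). (Equivalently, this computes the n-th Fourier coefficient of U_p applied to the Eisenstein series 𝓔_{k,N}^{(ε)}.) -/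
open Finset

/-- The divisors of `p * x` are the multiples `p * d` with `d ∣ x`, together with the divisors of
`x` that are prime to `p`. -/
lemma sum_divisors_prime_mul {M : Type*} [AddCommMonoid M] {p x : ℕ} (hp : p.Prime) (hx : x ≠ 0)
    (f : ℕ → M) :
    ∑ d ∈ (p * x).divisors, f d =
      ∑ d ∈ x.divisors, f (p * d) + ∑ d ∈ x.divisors with ¬ p ∣ d, f d := by
  rw [← sum_filter_add_sum_filter_not _ (fun d => p ∣ d)]
  congr 1
  · rw [← sum_image (f := f) (g := fun d => p * d)
      (fun a _ b _ h => Nat.eq_of_mul_eq_mul_left hp.pos h)]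
    congr 1
    ext d
    simp only [mem_filter, Nat.mem_divisors, mem_image]
    constructor
    · rintro ⟨⟨h, -⟩, c, rfl⟩
      exact ⟨c, ⟨Nat.dvd_of_mul_dvd_mul_left hp.pos h, hx⟩, rfl⟩
    · rintro ⟨c, ⟨h, -⟩, rfl⟩
      exact ⟨⟨Nat.mul_dvd_mul_left p h, mul_ne_zero hp.ne_zero hx⟩, dvd_mul_right p c⟩
  · congr 1
    ext d
    simp only [mem_filter, Nat.mem_divisors]
    constructor
    · rintro ⟨⟨h, -⟩, hd⟩
      exact ⟨⟨((hp.coprime_iff_not_dvd.2 hd).symm).dvd_of_dvd_mul_left h, hx⟩, hd⟩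
    · rintro ⟨⟨h, -⟩, hd⟩
      exact ⟨⟨h.mul_left p, mul_ne_zero hp.ne_zero hx⟩, hd⟩

/-- The Hecke recurrence `σ(px) = (1 + p^r) σ(x) - p^r σ(x/p)` for divisor power sums. -/
lemma sum_divisors_pow_prime_mul {p x : ℕ} (hp : p.Prime) (hx : x ≠ 0) (r : ℕ) :
    ∑ e ∈ (p * x).divisors, (e : ℤ) ^ r = (1 + (p : ℤ) ^ r) * ∑ e ∈ x.divisors, (e : ℤ) ^ r -
      (p : ℤ) ^ r * (if p ∣ x then ∑ e ∈ (x / p).divisors, (e : ℤ) ^ r else 0) := by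
  rw [sum_divisors_prime_mul hp hx]
  simp only [Nat.cast_mul, mul_pow, ← mul_sum]
  split_ifs with h
  · obtain ⟨y, rfl⟩ := h
    have hy : y ≠ 0 := right_ne_zero_of_mul hx
    have h1 := sum_divisors_prime_mul hp hy (fun e => (e : ℤ) ^ r)
    have h2 : ∑ e ∈ (p * y).divisors with ¬ p ∣ e, (e : ℤ) ^ r =
        ∑ e ∈ y.divisors with ¬ p ∣ e, (e : ℤ) ^ r := by
      have h3 := sum_divisors_prime_mul hp hy (fun e => if p ∣ e then 0 else (e : ℤ) ^ r)
      simp only [dvd_mul_right, if_true, sum_const_zero, zero_add] at h3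
      simpa [sum_filter, ite_not, ← ite_or] using h3
    simp only [Nat.cast_mul, mul_pow, ← mul_sum] at h1
    rw [Nat.mul_div_cancel_left y hp.pos, h2]
    linear_combination -h1
  · rw [filter_true_of_mem (p := fun e => ¬ p ∣ e) fun e he hpe =>
      h (dvd_trans hpe (Nat.dvd_of_mem_divisors he))]
    ring

/-- Let k = 2j ≥ 2 be even, N squarefree, ε an Atkin–Lehner
eigensystem for Γ₀(N), and p a prime dividing N.  With
a(m) = Σ_{d∣N} ε(d) d^{k/2} σ_{k−1}(m/d) (σ_{k−1}(m/d) = 0 when d ∤ m),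
for every n ≥ 1:
a(pn) = (1 + p^{k−1} + ε(p) p^{k/2}) a(n)
        − (1 + ε(p) p^{k/2})(1 + ε(p) p^{k/2−1}) Σ_{d∣N, p∣d} ε(d) d^{k/2} σ_{k−1}(n/d). -/
theorem eisenstein_Up_coefficient_formula
    (k j : ℕ) (hj : 1 ≤ j) (hk : k = 2 * j)
    (N : ℕ) (hN : Squarefree N) (hN0 : 0 < N)
    (ε : ℕ → ℤ) (hε1 : ε 1 = 1)
    (hεpm : ∀ d, d ∣ N → ε d = 1 ∨ ε d = -1)
    (hεmul : ∀ d₁ d₂, d₁ ∣ N → d₂ ∣ N → Nat.Coprime d₁ d₂ → ε (d₁ * d₂) = ε d₁ * ε d₂)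
    (p : ℕ) (hp : p.Prime) (hpN : p ∣ N)
    (a : ℕ → ℤ)
    (ha : ∀ m, 1 ≤ m → a m = ∑ d ∈ N.divisors, ε d * (d : ℤ) ^ j *
        (if d ∣ m then ∑ e ∈ (m / d).divisors, (e : ℤ) ^ (k - 1) else 0))
    (n : ℕ) (hn : 1 ≤ n) :
    a (p * n) = (1 + (p : ℤ) ^ (k - 1) + ε p * (p : ℤ) ^ j) * a n -
      (1 + ε p * (p : ℤ) ^ j) * (1 + ε p * (p : ℤ) ^ (j - 1)) *
        ∑ d ∈ N.divisors, (if p ∣ d then ε d * (d : ℤ) ^ j *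
          (if d ∣ n then ∑ e ∈ (n / d).divisors, (e : ℤ) ^ (k - 1) else 0) else 0) := by
  subst hk
  obtain ⟨i, rfl⟩ : ∃ i, j = i + 1 := ⟨j - 1, by omega⟩
  obtain ⟨M, rfl⟩ := hpN
  have hM : M ≠ 0 := right_ne_zero_of_mul hN0.ne'
  have hpM : Nat.Coprime p M := Nat.coprime_of_squarefree_mul hN
  have hcop : ∀ d ∈ M.divisors, Nat.Coprime p d := fun d hd =>
    hpM.coprime_dvd_right (Nat.dvd_of_mem_divisors hd)
  have hndvd : ∀ d ∈ M.divisors, ¬ p ∣ d := fun d hd => hp.coprime_iff_not_dvd.1 (hcop d hd)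
  have hεp : ε p * ε p = 1 := by
    rcases hεpm p (dvd_mul_right p M) with h | h <;> simp [h]
  have hεpd : ∀ d ∈ M.divisors, ε (p * d) = ε p * ε d := fun d hd =>
    hεmul p d (dvd_mul_right p M) ((Nat.dvd_of_mem_divisors hd).mul_left p) (hcop d hd)
  have hpn : 1 ≤ p * n := Nat.mul_pos hp.pos hn
  rw [ha n hn, ha (p * n) hpn]
  simp only [sum_divisors_prime_mul hp hM, filter_true_of_mem hndvd]
  rw [sum_congr rfl (g := fun _ => (0 : ℤ)) fun d hd => if_neg (hndvd d hd)]
  simp only [sum_const_zero, add_zero, dvd_mul_right, if_true, ← sum_add_distrib, mul_sum,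
    ← sum_sub_distrib]
  refine sum_congr rfl fun d hd => ?_
  rw [hεpd d hd]
  have hd0 : 0 < d := Nat.pos_of_mem_divisors hd
  by_cases hdn : d ∣ n
  · obtain ⟨x, rfl⟩ := hdn
    have hx : x ≠ 0 := right_ne_zero_of_mul (Nat.one_le_iff_ne_zero.1 hn)
    have h1 : p * d ∣ d * x ↔ p ∣ x := by
      rw [mul_comm p d, Nat.mul_dvd_mul_iff_left hd0]
    have h2 : d * x / (p * d) = x / p := by
      rw [mul_comm p d, Nat.mul_div_mul_left _ _ hd0]
    have h3 : p * (d * x) / d = p * x := by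
      rw [mul_left_comm, Nat.mul_div_cancel_left _ hd0]
    have h4 : p * (d * x) / (p * d) = x := by
      rw [← mul_assoc, Nat.mul_div_cancel_left _ (Nat.mul_pos hp.pos hd0)]
    have h5 : d ∣ p * (d * x) := (dvd_mul_right d x).mul_left p
    have h6 : p * d ∣ p * (d * x) := mul_dvd_mul_left p (dvd_mul_right d x)
    simp only [h1, h2, h3, h4, h5, h6, dvd_mul_right, if_true, Nat.mul_div_cancel_left _ hd0]
    rw [sum_divisors_pow_prime_mul hp hx]
    generalize (if p ∣ x then ∑ e ∈ (x / p).divisors, (e : ℤ) ^ (2 * (i + 1) - 1) else 0) = T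
    generalize ∑ e ∈ x.divisors, (e : ℤ) ^ (2 * (i + 1) - 1) = S
    rw [show 2 * (i + 1) - 1 = i + (i + 1) by omega, Nat.add_sub_cancel]
    push_cast
    simp only [mul_pow, pow_add, pow_one]
    linear_combination ε d * (d : ℤ) ^ i * d * T * (p : ℤ) ^ i * (p : ℤ) ^ i * p *
      (1 + ε p * (p : ℤ) ^ i * p) * hεp
  · have h1 : ¬ p * d ∣ n := fun h => hdn ((dvd_mul_left d p).trans h)
    have h2 : ¬ d ∣ p * n := fun h => hdn ((hcop d hd).symm.dvd_of_dvd_mul_left h)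
    have h3 : ¬ p * d ∣ p * n := fun h => hdn (Nat.dvd_of_mul_dvd_mul_left hp.pos h)
    simp [hdn, h1, h2, h3]
end

section
/- Let k ≥ 2 be an even integer, N = p₁⋯p_t a squarefree positive integer with distinct prime factors p₁,…,p_t, and ε an Atkin–Lehner eigensystem for Γ₀(N). Let ℓ be a prime not dividing N such that the ℓ-adic valuation of the rational number (B_k/(2k)) · ∏_{i=1}^t (1 + ε(p_i) p_i^{k/2}) is ≥ 1. Then for every positive divisor M of N, the ℓ-adic valuation of the rational number (B_k/(2k)) · Σ_{d∣N} ε(d) d^{k/2} gcd(d,M)^k / d^k is ≥ 1. (That is, the constant term of 𝓔_{k,N}^{(ε)} at every cusp of Γ₀(N) is congruent to 0 modulo ℓ, so 𝓔_{k,N}^{(ε)} reduces to a mod ℓ cusp form.) -/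
open Finset

/-- For `N` squarefree, a function that is multiplicative on the divisors of `N` satisfies
`∑ d ∣ N, f d = ∏ p ∣ N, (1 + f p)`. -/
theorem sum_divisors_eq_prod_primeFactors_one_add {R : Type*} [CommSemiring R] {N : ℕ}
    (hN : Squarefree N) {f : ℕ → R} (hf1 : f 1 = 1)
    (hf : ∀ d₁ d₂, d₁ ∣ N → d₂ ∣ N → Nat.Coprime d₁ d₂ → f (d₁ * d₂) = f d₁ * f d₂) :
    ∑ d ∈ N.divisors, f d = ∏ p ∈ N.primeFactors, (1 + f p) := by
  let F : ArithmeticFunction R := ⟨fun n => if n = 0 then 0 else f (n.gcd N), by simp⟩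
  have hF : ∀ d, d ∣ N → F d = f d := fun d hd => by
    have hd0 : d ≠ 0 := ne_zero_of_dvd_ne_zero hN.ne_zero hd
    simp [F, hd0, Nat.gcd_eq_left hd]
  have hmult : F.IsMultiplicative := by
    rw [ArithmeticFunction.IsMultiplicative.iff_ne_zero]
    refine ⟨by simp [hF, hf1], fun {a b} ha hb hab => ?_⟩
    simpa [F, ha, hb, hab.mul_gcd] using
      hf _ _ (a.gcd_dvd_right N) (b.gcd_dvd_right N)
        (hab.of_dvd (a.gcd_dvd_left N) (b.gcd_dvd_left N))
  calc ∑ d ∈ N.divisors, f d = ∑ d ∈ N.divisors, F d :=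
        sum_congr rfl fun d hd => (hF d (Nat.dvd_of_mem_divisors hd)).symm
    _ = ∏ p ∈ N.primeFactors, (1 + F p) := (hmult.prodPrimeFactors_one_add_of_squarefree hN).symm
    _ = _ := prod_congr rfl fun p hp => by rw [hF p (Nat.dvd_of_mem_primeFactors hp)]

/-- A finite product of rational numbers that are `ℓ`-adic units is an `ℓ`-adic unit. -/
theorem prod_ne_zero_and_padicValRat_prod_eq_zero {ι : Type*} {ℓ : ℕ} [Fact ℓ.Prime]
    (s : Finset ι) {u : ι → ℚ} (hu : ∀ i ∈ s, u i ≠ 0 ∧ padicValRat ℓ (u i) = 0) :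
    ∏ i ∈ s, u i ≠ 0 ∧ padicValRat ℓ (∏ i ∈ s, u i) = 0 := by
  refine prod_induction u (fun q => q ≠ 0 ∧ padicValRat ℓ q = 0) ?_ ⟨one_ne_zero, by simp⟩ hu
  rintro a b ⟨ha, ha'⟩ ⟨hb, hb'⟩
  exact ⟨mul_ne_zero ha hb, by rw [padicValRat.mul ha hb, ha', hb', add_zero]⟩

/-- Let k = 2m ≥ 2 be even, N squarefree with prime factors
p₁,…,p_t, and ε an Atkin–Lehner eigensystem for Γ₀(N).  Let ℓ be a prime not
dividing N such that v_ℓ((B_k/(2k)) ∏_{p∣N}(1 + ε(p) p^{k/2})) ≥ 1.  Then for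
every positive divisor M of N,
v_ℓ((B_k/(2k)) Σ_{d∣N} ε(d) d^{k/2} gcd(d,M)^k / d^k) ≥ 1. -/
theorem eisenstein_constant_terms_vanish_mod_ell
    (k m : ℕ) (hm : 1 ≤ m) (hk : k = 2 * m)
    (N : ℕ) (hN : Squarefree N) (hN0 : 0 < N)
    (ε : ℕ → ℤ) (hε1 : ε 1 = 1)
    (hεpm : ∀ d, d ∣ N → ε d = 1 ∨ ε d = -1)
    (hεmul : ∀ d₁ d₂, d₁ ∣ N → d₂ ∣ N → Nat.Coprime d₁ d₂ → ε (d₁ * d₂) = ε d₁ * ε d₂)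
    (ℓ : ℕ) (hℓ : ℓ.Prime) (hℓN : ¬ ℓ ∣ N)
    (hval : 1 ≤ padicValRat ℓ ((bernoulli k / (2 * k)) *
      ∏ p ∈ N.primeFactors, (1 + (ε p : ℚ) * (p : ℚ) ^ m)))
    (M : ℕ) (hM : M ∣ N) :
    1 ≤ padicValRat ℓ ((bernoulli k / (2 * k)) *
      ∑ d ∈ N.divisors, (ε d : ℚ) * (d : ℚ) ^ m * (Nat.gcd d M : ℚ) ^ k / (d : ℚ) ^ k) := by
  have : Fact ℓ.Prime := ⟨hℓ⟩
  have hN' : ∀ d, d ∣ N → (d : ℚ) ≠ 0 := fun d hd =>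
    Nat.cast_ne_zero.2 (ne_zero_of_dvd_ne_zero hN.ne_zero hd)
  rw [sum_divisors_eq_prod_primeFactors_one_add hN (by simp [hε1])]
  · let u : ℕ → ℚ := fun p => if p ∣ M then 1 else (ε p : ℚ) / (p : ℚ) ^ m
    have hu : ∀ p ∈ N.primeFactors, u p ≠ 0 ∧ padicValRat ℓ (u p) = 0 := by
      intro p hp
      have hpN := Nat.dvd_of_mem_primeFactors hp
      have hval_p : padicValRat ℓ ((p : ℚ) ^ m) = 0 := by
        rw [padicValRat.pow, padicValRat.of_nat,
          padicValNat.eq_zero_of_not_dvd fun h => hℓN (h.trans hpN)]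
        simp
      by_cases hpM : p ∣ M
      · simp [u, hpM]
      · rcases hεpm p hpN with h | h <;>
          simp [u, hpM, h, hN' p hpN, neg_div, padicValRat.neg, padicValRat.inv, hval_p,
            -padicValRat.pow]
    have hfactor : ∀ p ∈ N.primeFactors,
        1 + (ε p : ℚ) * (p : ℚ) ^ m * (Nat.gcd p M : ℚ) ^ k / (p : ℚ) ^ k =
          u p * (1 + (ε p : ℚ) * (p : ℚ) ^ m) := by
      intro p hp
      have hpN := Nat.dvd_of_mem_primeFactors hp
      have hp0 := hN' p hpN
      by_cases hpM : p ∣ M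
      · simp [u, hpM, Nat.gcd_eq_left hpM, hp0]
      · have hgcd : Nat.gcd p M = 1 :=
          ((Nat.prime_of_mem_primeFactors hp).coprime_iff_not_dvd).2 hpM
        have hsq : (ε p : ℚ) ^ 2 = 1 := by rcases hεpm p hpN with h | h <;> simp [h]
        simp only [u, hpM, hgcd, if_false, hk, Nat.cast_one, one_pow]
        field_simp
        linear_combination -(p : ℚ) ^ (3 * m) * hsq
    obtain ⟨hu0, huval⟩ := prod_ne_zero_and_padicValRat_prod_eq_zero N.primeFactors hu
    have hne : bernoulli k / (2 * k) *
        ∏ p ∈ N.primeFactors, (1 + (ε p : ℚ) * (p : ℚ) ^ m) ≠ 0 := by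
      intro h
      simp [h] at hval
    rw [prod_congr rfl hfactor, prod_mul_distrib, mul_left_comm, padicValRat.mul hu0 hne, huval,
      zero_add]
    exact hval
  · intro d₁ d₂ h₁ h₂ hcop
    rw [hεmul d₁ d₂ h₁ h₂ hcop, hcop.mul_gcd]
    push_cast
    ring
end

section
/- Let γ = (u v; x w) ∈ SL₂(ℤ), let d ≥ 1 be an integer, and set d' = d/gcd(x,d). Then for every pair (a,b) ∈ ℤ² ∖ {(0,0)} satisfying a·d·u + b·x = 0, one has a·d·v + b·w ≠ 0, and the (absolutely convergent) sum Σ over all (a,b) ∈ ℤ² ∖ {(0,0)} with a·d·u + b·x = 0 of 1/(a·d·v + b·w)² equals 2ζ(2)/d'² = π²/(3 d'²). -/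
theorem hasSum_int_one_div_sq :
    HasSum (fun n : ℤ => (1 : ℝ) / (n : ℝ) ^ 2) (Real.pi ^ 2 / 3) := by
  have h : HasSum (fun n : ℕ => (1 : ℝ) / (((n : ℤ) : ℝ)) ^ 2) (Real.pi ^ 2 / 6) := by
    simpa using hasSum_zeta_two
  have h' : HasSum (fun n : ℕ => (1 : ℝ) / (((-(n : ℤ) : ℤ) : ℝ)) ^ 2) (Real.pi ^ 2 / 6) := by
    simpa using hasSum_zeta_two
  have hsum := HasSum.of_nat_of_neg (f := fun n : ℤ => (1 : ℝ) / (n : ℝ) ^ 2) h h'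
  have heq : Real.pi ^ 2 / 6 + Real.pi ^ 2 / 6 - 1 / (((0 : ℤ) : ℝ)) ^ 2 = Real.pi ^ 2 / 3 := by
    norm_num
    ring
  exact heq ▸ hsum

theorem hasSum_ne_zero_one_div_mul_sq (c : ℝ) :
    HasSum (fun n : {n : ℤ // n ≠ 0} => (1 : ℝ) / (c * (n : ℤ)) ^ 2)
      (Real.pi ^ 2 / (3 * c ^ 2)) := by
  have h : HasSum (fun n : ℤ => (1 : ℝ) / (c * n) ^ 2) (Real.pi ^ 2 / (3 * c ^ 2)) := by
    have hmul : HasSum (fun n : ℤ => 1 / c ^ 2 * (1 / (n : ℝ) ^ 2))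
        (1 / c ^ 2 * (Real.pi ^ 2 / 3)) := hasSum_int_one_div_sq.mul_left (1 / c ^ 2)
    simpa only [mul_pow, div_mul_div_comm, one_mul, mul_comm (3 : ℝ)] using hmul
  refine (hasSum_subtype_iff_of_support_subset (s := {n : ℤ | n ≠ 0}) ?_).2 h
  rintro n hn rfl
  simp at hn

/-- The solutions of `a * d * u + b * x = 0` are the multiples of `(-x', d' * u)`, where
`x' = x / gcd(x, d)` and `d' = d / gcd(x, d)`. -/
theorem exists_eq_mul_of_line {u v x w d x' d' g : ℤ} (hdet : u * w - v * x = 1)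
    (hg : g ≠ 0) (hd' : d' ≠ 0) (hx : x = x' * g) (hd : d = d' * g) (hco : IsCoprime d' x')
    {a b : ℤ} (hab : a * d * u + b * x = 0) :
    ∃ n : ℤ, a = -(n * x') ∧ b = n * (d' * u) := by
  have hb : (a * d * v + b * w) * u = b := by linear_combination v * hab + b * hdet
  have ha : (a * d * v + b * w) * x = -(a * d) := by linear_combination w * hab - a * d * hdet
  have ha' : (a * d * v + b * w) * x' = -(a * d') := by
    apply mul_right_cancel₀ hg
    linear_combination ha - (a * d * v + b * w) * hx - a * hd
  obtain ⟨n, hn⟩ : d' ∣ a * d * v + b * w :=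
    hco.dvd_of_dvd_mul_right ⟨-a, by linear_combination ha'⟩
  refine ⟨n, mul_left_cancel₀ hd' ?_, ?_⟩
  · linear_combination ha' - x' * hn
  · linear_combination -hb + u * hn


/-- Let γ = (u v; x w) ∈ SL₂(ℤ), d ≥ 1 an integer, and
d' = d/gcd(x,d).  Then every (a,b) ∈ ℤ² ∖ {(0,0)} with adu + bx = 0 satisfies
adv + bw ≠ 0; the family 1/(adv+bw)² over such pairs is summable; and its sum
equals 2ζ(2)/d'² = π²/(3 d'²). -/
theorem lattice_line_sum_eq
    (u v x w : ℤ) (hdet : u * w - v * x = 1)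
    (d : ℕ) (hd : 1 ≤ d)
    (d' : ℕ) (hd' : d' = d / Int.gcd x (d : ℤ)) :
    (∀ ab : ℤ × ℤ, ab ≠ (0, 0) → ab.1 * d * u + ab.2 * x = 0 →
        ab.1 * d * v + ab.2 * w ≠ 0) ∧
    Summable (fun ab : {ab : ℤ × ℤ // ab ≠ (0, 0) ∧ ab.1 * d * u + ab.2 * x = 0} =>
        (1 : ℝ) / ((ab.1.1 : ℝ) * d * v + (ab.1.2 : ℝ) * w) ^ 2) ∧
    ∑' ab : {ab : ℤ × ℤ // ab ≠ (0, 0) ∧ ab.1 * d * u + ab.2 * x = 0},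
        (1 : ℝ) / ((ab.1.1 : ℝ) * d * v + (ab.1.2 : ℝ) * w) ^ 2
      = Real.pi ^ 2 / (3 * (d' : ℝ) ^ 2) := by
  have hne : ∀ ab : ℤ × ℤ, ab ≠ (0, 0) → ab.1 * d * u + ab.2 * x = 0 →
      ab.1 * d * v + ab.2 * w ≠ 0 := by
    rintro ⟨a, b⟩ h0 hab ht
    dsimp only at hab ht
    have hb : b = 0 := by linear_combination u * ht - v * hab - b * hdet
    have ha : a * d = 0 := by linear_combination w * hab - x * ht - a * d * hdet
    have hd0 : (d : ℤ) ≠ 0 := by positivity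
    exact h0 (Prod.ext ((mul_eq_zero.1 ha).resolve_right hd0) hb)
  have hgpos : 0 < Int.gcd x d := Int.gcd_pos_of_ne_zero_right _ (by positivity)
  obtain ⟨x', e, hco, hx, he⟩ := Int.exists_gcd_one hgpos
  have hed : e = d' := by
    rw [hd', Int.natCast_div]
    exact (Int.ediv_eq_of_eq_mul_left (by positivity) he).symm
  subst hed
  have hd'0 : (d' : ℤ) ≠ 0 := by
    rintro h
    rw [h, zero_mul] at he
    omega
  have hco' : IsCoprime (d' : ℤ) x' := (Int.isCoprime_iff_gcd_eq_one.2 hco).symm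
  have hval (n : ℤ) : -(n * x') * d * v + n * (d' * u) * w = d' * n := by
    linear_combination n * d' * hdet + n * v * d' * hx - n * x' * v * he
  have hline (n : ℤ) : -(n * x') * d * u + n * (d' * u) * x = 0 := by
    linear_combination n * d' * u * hx - n * x' * u * he
  let f : {n : ℤ // n ≠ 0} →
      {ab : ℤ × ℤ // ab ≠ (0, 0) ∧ ab.1 * d * u + ab.2 * x = 0} := fun n =>
    ⟨(-(n * x'), n * (d' * u)), by
      intro h
      have h1 := congrArg Prod.fst h
      have h2 := congrArg Prod.snd h
      dsimp only at h1 h2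
      have h3 := hval n
      rw [h1, h2] at h3
      exact mul_ne_zero hd'0 n.2 (by linear_combination -h3), hline n⟩
  have hf : Function.Bijective f := by
    constructor
    · intro m n h
      have h1 : -((m : ℤ) * x') = -(n * x') := congrArg (fun p => p.1.1) h
      have h2 : (m : ℤ) * (d' * u) = n * (d' * u) := congrArg (fun p => p.1.2) h
      have hm := hval m
      rw [h1, h2, hval n] at hm
      exact Subtype.ext (mul_left_cancel₀ hd'0 hm.symm)
    · rintro ⟨⟨a, b⟩, h0, hab⟩
      obtain ⟨n, rfl, rfl⟩ :=
        exists_eq_mul_of_line hdet (by positivity) hd'0 hx he hco' hab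
      exact ⟨⟨n, by rintro rfl; simp at h0⟩, rfl⟩
  have hsum : HasSum (fun ab : {ab : ℤ × ℤ // ab ≠ (0, 0) ∧ ab.1 * d * u + ab.2 * x = 0} =>
      (1 : ℝ) / ((ab.1.1 : ℝ) * d * v + (ab.1.2 : ℝ) * w) ^ 2)
      (Real.pi ^ 2 / (3 * (d' : ℝ) ^ 2)) := by
    rw [← (Equiv.ofBijective f hf).hasSum_iff]
    convert hasSum_ne_zero_one_div_mul_sq (d' : ℝ) using 1
    ext n
    have h : ((-(n * x') : ℤ) : ℝ) * d * v + ((n * (d' * u) : ℤ) : ℝ) * w = d' * (n : ℤ) := by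
      exact_mod_cast hval n
    simp only [Function.comp_apply, Equiv.ofBijective_apply, f, h]
  exact ⟨hne, hsum.summable, hsum.tsum_eq⟩
end

section
/- Let γ = (u v; x w) ∈ SL₂(ℤ), let d ≥ 1 be an integer, and set d' = d/gcd(x,d). Let E₂ be the function on the upper half-plane E₂(z) = −1/24 + Σ_{n≥1} σ₁(n) e^{2πinz}. Then the limit as t → +∞ of (x·(it) + w)^{−2} · E₂(d · (u·(it) + v)/(x·(it) + w)) exists and equals −1/(24 d'²). (That is, the constant term of the Fourier expansion of E₂(dz)|₂γ is −(1/d'²)·(B₂/4), where B₂ = 1/6 is the second Bernoulli number; this extends Billerey–Menares' constant-term formula to weight k = 2.) -/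
open Filter Complex

/-- The weight-2, level-1 Eisenstein series
E₂(z) = −1/24 + Σ_{n≥1} σ₁(n) e^{2πinz}, as a function on ℂ (the series
converges for Im z > 0). -/
noncomputable def E2 (z : ℂ) : ℂ :=
  -(1 / 24) + ∑' n : ℕ+, (∑ e ∈ (n : ℕ).divisors, (e : ℂ)) *
    Complex.exp (2 * Real.pi * Complex.I * ((n : ℕ) : ℂ) * z)

open UpperHalfPlane hiding I
open scoped Topology MatrixGroups ModularForm

/-- A function given on the upper half-plane by a convergent `q`-expansion tends at `i∞` to the
constant term of that expansion. -/
lemma tendsto_atImInfty_of_hasSum_qExpansion {f : ℍ → ℂ} {c : ℕ → ℂ} {h : ℝ} (hh : 0 < h)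
    (hf : ∀ τ : ℍ, HasSum (fun m ↦ c m • Function.Periodic.qParam h τ ^ m) (f τ)) :
    Tendsto f atImInfty (𝓝 (c 0)) := by
  have hbound := (hf UpperHalfPlane.I).summable.norm
  have hlim : Tendsto (fun τ : ℍ ↦ ∑' m, c m • Function.Periodic.qParam h τ ^ m) atImInfty
      (𝓝 (∑' m, c m • (0 : ℂ) ^ m)) := by
    refine tendsto_tsum_of_dominated_convergence hbound
      (fun m ↦ ((qParam_tendsto_atImInfty hh).pow m).const_smul (c m)) ?_
    filter_upwards [(atImInfty_mem {τ : ℍ | 1 ≤ τ.im}).mpr ⟨1, fun _ hz ↦ hz⟩] with τ hτ m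
    rw [norm_smul, norm_smul, norm_pow, norm_pow]
    gcongr
    rw [Function.Periodic.norm_qParam, Function.Periodic.norm_qParam]
    refine Real.exp_le_exp.mpr (div_le_div_of_nonneg_right ?_ hh.le)
    have : (UpperHalfPlane.I : ℂ).im = 1 := by simp
    rw [this]
    exact mul_le_mul_of_nonpos_left hτ (by linarith [Real.pi_pos])
  rw [tsum_eq_single 0 (fun m hm ↦ by simp [hm])] at hlim
  rw [pow_zero, smul_eq_mul, mul_one] at hlim
  exact hlim.congr fun τ ↦ (hf τ).tsum_eq

lemma tendsto_eisensteinSeriesE2_atImInfty :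
    Tendsto EisensteinSeries.E2 atImInfty (𝓝 1) := by
  refine tendsto_atImInfty_of_hasSum_qExpansion
    (c := fun m ↦ if m = 0 then 1 else -24 * ArithmeticFunction.sigma 1 m) one_pos fun τ ↦ ?_
  simpa only [Function.Periodic.qParam, ofReal_one, div_one] using
    EisensteinSeries.hasSum_qExpansion_E2 (z := τ)

lemma E2_coe_eq (z : ℍ) : E2 z = -(1 / 24) * EisensteinSeries.E2 z := by
  rw [EisensteinSeries.E2_eq_tsum_cexp, E2]
  have (n : ℕ+) : (∑ e ∈ (n : ℕ).divisors, (e : ℂ)) *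
      cexp (2 * Real.pi * I * ((n : ℕ) : ℂ) * z) =
      (ArithmeticFunction.sigma 1 n : ℂ) * cexp (2 * Real.pi * I * z) ^ (n : ℕ) := by
    rw [ArithmeticFunction.sigma_one_apply, ← Complex.exp_nat_mul]
    push_cast
    ring_nf
  simp_rw [this]
  ring

/-- The defect of modularity of `E₂` vanishes at `i∞`, so the slash of `E₂` by any element of
`SL₂(ℤ)` tends to `1`. -/
lemma tendsto_eisensteinSeriesE2_slash_atImInfty (γ : SL(2, ℤ)) :
    Tendsto (EisensteinSeries.E2 ∣[(2 : ℤ)] γ) atImInfty (𝓝 1) := by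
  rw [EisensteinSeries.E2_slash_action]
  have hD : Tendsto (EisensteinSeries.D2 γ) atImInfty (𝓝 0) := by
    unfold EisensteinSeries.D2
    by_cases hc : γ 1 0 = 0
    · simp [hc]
    have hden : Tendsto (fun z : ℍ ↦ denom γ z) atImInfty (Bornology.cobounded ℂ) := by
      rw [← tendsto_norm_atTop_iff_cobounded]
      refine tendsto_atTop_mono (f := fun z : ℍ ↦ |(γ 1 0 : ℝ)| * z.im) (fun z ↦ ?_)
        (tendsto_comap.const_mul_atTop (by positivity))
      refine le_trans (le_of_eq ?_) (Complex.abs_im_le_norm _)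
      rw [ModularGroup.denom_apply]
      simp [abs_mul, abs_of_pos z.im_pos]
    simpa [div_eq_mul_inv] using (tendsto_inv₀_cobounded.comp hden).const_mul
      (2 * Real.pi * I * γ 1 0)
  have := tendsto_eisensteinSeriesE2_atImInfty.sub (hD.const_smul (1 / (2 * riemannZeta 2)))
  rwa [smul_zero, sub_zero] at this

/-- An integral matrix `(d u, d v; x, w)` with `u w - v x = 1` is the product of an element
`(a, b; c, e)` of `SL₂(ℤ)` and the upper triangular matrix `(g, B; 0, d / g)`, `g = gcd(x, d)`. -/
lemma exists_SL2_mul_upperTriangular {u v x w : ℤ} (hdet : u * w - v * x = 1) {d : ℕ}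
    (hd : 1 ≤ d) :
    ∃ (γ : SL(2, ℤ)) (B : ℤ),
      γ 0 0 * (Int.gcd x d) = d * u ∧ γ 0 0 * B + γ 0 1 * (d / Int.gcd x d : ℕ) = d * v ∧
      γ 1 0 * (Int.gcd x d) = x ∧ γ 1 0 * B + γ 1 1 * (d / Int.gcd x d : ℕ) = w := by
  have hg : 0 < Int.gcd x d := Int.gcd_pos_of_ne_zero_right _ (by omega)
  obtain ⟨x', k, hcop, hx, hk⟩ := Int.exists_gcd_one hg
  have hk' : ((d / Int.gcd x d : ℕ) : ℤ) = k := by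
    rw [Int.natCast_div]
    exact Int.ediv_eq_of_eq_mul_left (by omega) hk
  rw [hk']
  set g := Int.gcd x d
  have hux : IsCoprime u x' := ⟨w, -v * g, by linear_combination hdet + v * hx⟩
  obtain ⟨e, b, heb⟩ := (Int.isCoprime_iff_gcd_eq_one.mpr hcop).symm.mul_left hux
  refine ⟨⟨!![k * u, -b; x', e], by rw [Matrix.det_fin_two_of]; linear_combination heb⟩,
    e * d * v + b * w, ?_, ?_, ?_, ?_⟩
  · simp only [Matrix.of_apply, Matrix.cons_val]
    linear_combination -u * hk
  · simp only [Matrix.of_apply, Matrix.cons_val]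
    linear_combination d * v * heb + b * k * hdet + b * v * k * hx - b * v * x' * hk
  · exact hx.symm
  · simp only [Matrix.of_apply, Matrix.cons_val]
    linear_combination w * heb - e * k * hdet - e * v * k * hx + e * v * x' * hk

/-- Let γ = (u v; x w) ∈ SL₂(ℤ), d ≥ 1 an integer, and
d' = d/gcd(x,d).  Then the limit as t → +∞ of
(x·(it)+w)^{−2} · E₂(d·(u·(it)+v)/(x·(it)+w)) exists and equals −1/(24 d'²);
i.e. the constant term of E₂(dz)|₂γ is −(1/d'²)·(B₂/4). -/
theorem constant_term_E2_slash
    (u v x w : ℤ) (hdet : u * w - v * x = 1)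
    (d : ℕ) (hd : 1 ≤ d)
    (d' : ℕ) (hd' : d' = d / Int.gcd x (d : ℤ)) :
    Tendsto (fun t : ℝ =>
        ((x : ℂ) * (t * Complex.I) + (w : ℂ))⁻¹ ^ 2 *
          E2 ((d : ℂ) * (((u : ℂ) * (t * Complex.I) + (v : ℂ)) /
            ((x : ℂ) * (t * Complex.I) + (w : ℂ)))))
      atTop (nhds (-(1 / (24 * (d' : ℂ) ^ 2)))) := by
  obtain ⟨γ, B, h00, h01, h10, h11⟩ := exists_SL2_mul_upperTriangular hdet hd
  have hgpos : 0 < Int.gcd x d := Int.gcd_pos_of_ne_zero_right _ (by omega)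
  have hd'pos : 0 < d' := hd' ▸ Nat.div_pos
    (Nat.le_of_dvd hd (Int.natCast_dvd_natCast.mp (Int.gcd_dvd_right x d))) hgpos
  rw [← hd'] at h01 h11
  set g := Int.gcd x d
  have him (t : ℝ) : (((g : ℂ) * (t * I) + B) / d').im = g * t / d' := by
    simp [← ofReal_natCast, Complex.div_ofReal_im]
  have hpos (t : ℝ) (ht : 0 < t) : 0 < (((g : ℂ) * (t * I) + B) / d').im := by
    rw [him]; positivity
  let τ (t : ℝ) : ℍ := if ht : 0 < t then ⟨_, hpos t ht⟩ else UpperHalfPlane.I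
  have hτ {t : ℝ} (ht : 0 < t) : (τ t : ℂ) = ((g : ℂ) * (t * I) + B) / d' := by simp [τ, ht]
  have hτ_lim : Tendsto τ atTop atImInfty := by
    refine tendsto_comap_iff.mpr (Tendsto.congr' (f₁ := fun t : ℝ ↦ (g : ℝ) * t / d') ?_ ?_)
    · filter_upwards [eventually_gt_atTop 0] with t ht
      rw [← him, ← hτ ht]; rfl
    · exact (tendsto_id.const_mul_atTop (by positivity)).atTop_div_const (by positivity)
  have key := ((tendsto_eisensteinSeriesE2_slash_atImInfty γ).comp hτ_lim).const_mul
    (-(1 / (24 * (d' : ℂ) ^ 2)))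
  rw [mul_one] at key
  refine key.congr' ?_
  filter_upwards [eventually_gt_atTop 0] with t ht
  have hd'0 : (d' : ℂ) ≠ 0 := by exact_mod_cast hd'pos.ne'
  have hden : (d' : ℂ) * denom γ (τ t) = x * (t * I) + w := by
    rw [ModularGroup.denom_apply, hτ ht, ← h10, ← h11]
    push_cast
    field_simp
    ring
  have hnum : (d : ℂ) * ((u * (t * I) + v) / (x * (t * I) + w)) = ↑(γ • τ t) := by
    have h00' : (γ 0 0 : ℂ) * g = d * u := by exact_mod_cast h00
    have h01' : (γ 0 0 : ℂ) * B + γ 0 1 * d' = d * v := by exact_mod_cast h01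
    rw [coe_specialLinearGroup_apply, ← hden, ModularGroup.denom_apply, hτ ht, ← mul_div_assoc,
      show (d : ℂ) * (u * (t * I) + v) = d' * (γ 0 0 * ((g * (t * I) + B) / d') + γ 0 1) by
        field_simp
        linear_combination -(t * I) * h00' - h01',
      mul_div_mul_left _ _ hd'0]
    simp
  rw [hnum, E2_coe_eq, ← hden, Function.comp_apply, ModularForm.SL_slash_apply]
  have := denom_ne_zero (γ : GL (Fin 2) ℝ) (τ t)
  simp only [zpow_neg]
  field_simp
end
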